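/- arXiv:1601.01482 — 3 statements merged into one kernel-verified Lean document; each statement's English description precedes it below -/
import Mathlib

section
/- Suppose p ∈ ℝ[x₁, …, xₙ], q ∈ ℝ[y₁, …, yₘ], h₁, …, hₙ ∈ ℒ, and k₁, …, kₘ ∈ ℒ are such that p(Φ(h₁), …, Φ(hₙ)) = q(Φ(k₁), …, Φ(kₘ)) ℙ-almost everywhere. Then for every l ∈ ℒ, Σᵢ₌₁ⁿ (∂p/∂xᵢ)(Φ(h₁), …, Φ(hₙ))·⟨hᵢ, l⟩ = Σⱼ₌₁ᵐ (∂q/∂yⱼ)(Φ(k₁), …, Φ(kₘ))·⟨kⱼ, l⟩ ℙ-almost everywhere. That is, the Malliavin derivative T_k is independent of the chosen polynomial representation, hence is a well-defined linear operator on the polynomial fields. -/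
open MeasureTheory
open scoped RealInnerProductSpace

namespace MvPolynomial

/-- The chain rule for a polynomial along an affine line. -/
lemma hasDerivAt_eval_add_mul {σ : Type*} [Fintype σ] (a b : σ → ℝ) (p : MvPolynomial σ ℝ)
    (t : ℝ) :
    HasDerivAt (fun s : ℝ => eval (fun i => a i + s * b i) p)
      (∑ i, eval (fun j => a j + t * b j) (pderiv i p) * b i) t := by
  classical
  induction p using MvPolynomial.induction_on with
  | C c => simpa using hasDerivAt_const t c
  | add p q hp hq => simpa [add_mul, Finset.sum_add_distrib] using hp.fun_add hq
  | mul_X p j hp =>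
    have hX : HasDerivAt (fun s : ℝ => a j + s * b j) (b j) t := by
      simpa using ((hasDerivAt_id t).mul_const (b j)).const_add (a j)
    simp only [map_mul, eval_X]
    refine (hp.fun_mul hX).congr_deriv ?_
    simp only [Derivation.leibniz, pderiv_X, Pi.single_apply, smul_eq_mul, mul_ite, mul_one,
      mul_zero, map_add, map_mul, eval_X, apply_ite (eval _), map_zero, add_mul, ite_mul, zero_mul,
      Finset.sum_add_distrib, Finset.sum_ite_eq, Finset.mem_univ, if_true,
      Finset.sum_mul]
    rw [add_comm]
    congr 1
    rw [← Finset.sum_add_distrib]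
    exact Finset.sum_congr rfl fun i _ => by ring

end MvPolynomial

namespace ProbabilityTheory

instance isOpenPosMeasure_stdGaussian {E : Type*} [NormedAddCommGroup E] [InnerProductSpace ℝ E]
    [FiniteDimensional ℝ E] [MeasurableSpace E] [BorelSpace E] :
    (stdGaussian E).IsOpenPosMeasure := by
  have : (gaussianReal 0 1).IsOpenPosMeasure :=
    (gaussianReal_absolutelyContinuous' 0 one_ne_zero).isOpenPosMeasure
  refine Continuous.isOpenPosMeasure_map (by fun_prop) fun x => ?_
  exact ⟨fun i => ⟪stdOrthonormalBasis ℝ E i, x⟫, (stdOrthonormalBasis ℝ E).sum_repr' x⟩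

/-- A Gaussian field over a finite-dimensional Euclidean space is given by the inner products
with a standard Gaussian vector. -/
lemma exists_map_eq_stdGaussian {Ω : Type*} [MeasurableSpace Ω] (P : Measure Ω)
    [IsProbabilityMeasure P] {E : Type*} [NormedAddCommGroup E] [InnerProductSpace ℝ E]
    [FiniteDimensional ℝ E] [MeasurableSpace E] [BorelSpace E] (Φ : E →ₗ[ℝ] (Ω → ℝ))
    (hmeas : ∀ v, Measurable (Φ v))
    (hchar : ∀ v, ∫ ω, Complex.exp (Complex.I * (Φ v ω : ℂ)) ∂P
      = (Real.exp (-‖v‖ ^ 2 / 2) : ℂ)) :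
    ∃ X : Ω → E, Measurable X ∧ (∀ v ω, ⟪v, X ω⟫ = Φ v ω) ∧ P.map X = stdGaussian E := by
  let b := stdOrthonormalBasis ℝ E
  let X : Ω → E := fun ω => ∑ i, Φ (b i) ω • b i
  have hX : Measurable X :=
    Finset.measurable_fun_sum _ fun i _ => (hmeas (b i)).smul_const (b i)
  have hinner : ∀ v ω, ⟪v, X ω⟫ = Φ v ω := fun v ω => by
    conv_rhs => rw [← b.sum_repr' v]
    simp [X, inner_sum, inner_smul_right, real_inner_comm, mul_comm]
  refine ⟨X, hX, hinner, ?_⟩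
  have := Measure.isProbabilityMeasure_map (μ := P) hX.aemeasurable
  refine Measure.ext_of_charFun (funext fun v => ?_)
  rw [charFun_stdGaussian, charFun_apply, integral_map hX.aemeasurable (by fun_prop)]
  simp_rw [real_inner_comm, hinner, mul_comm _ Complex.I, hchar]
  push_cast
  rfl

end ProbabilityTheory

/-- The Malliavin derivative is independent of the polynomial
representation: if p(Φ(h₁),…,Φ(hₙ)) = q(Φ(k₁),…,Φ(kₘ)) ℙ-a.e., then for every l ∈ ℒ,
Σᵢ (∂p/∂xᵢ)(Φ(h₁),…,Φ(hₙ))·⟨hᵢ,l⟩ = Σⱼ (∂q/∂yⱼ)(Φ(k₁),…,Φ(kₘ))·⟨kⱼ,l⟩ ℙ-a.e. -/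
theorem malliavinDerivative_wellDefined
    {Ω : Type*} [MeasurableSpace Ω] (P : Measure Ω) [IsProbabilityMeasure P]
    {L : Type*} [NormedAddCommGroup L] [InnerProductSpace ℝ L]
    (Φ : L →ₗ[ℝ] (Ω → ℝ))
    (hmeas : ∀ k : L, Measurable (Φ k))
    (hchar : ∀ k : L, ∫ ω, Complex.exp (Complex.I * (Φ k ω : ℂ)) ∂P
        = (Real.exp (-‖k‖ ^ 2 / 2) : ℂ))
    {n m : ℕ} (h : Fin n → L) (k : Fin m → L)
    (p : MvPolynomial (Fin n) ℝ) (q : MvPolynomial (Fin m) ℝ)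
    (heq : ∀ᵐ ω ∂P, MvPolynomial.eval (fun i => Φ (h i) ω) p
        = MvPolynomial.eval (fun j => Φ (k j) ω) q)
    (l : L) :
    ∀ᵐ ω ∂P,
      ∑ i : Fin n,
          MvPolynomial.eval (fun i' => Φ (h i') ω) (MvPolynomial.pderiv i p) * ⟪h i, l⟫
        = ∑ j : Fin m,
            MvPolynomial.eval (fun j' => Φ (k j') ω) (MvPolynomial.pderiv j q) * ⟪k j, l⟫ := by
  let V : Submodule ℝ L := Submodule.span ℝ (Set.range h ∪ Set.range k ∪ {l})
  have hV : (Set.range h ∪ Set.range k ∪ {l}).Finite :=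
    ((Set.finite_range h).union (Set.finite_range k)).union (Set.finite_singleton l)
  have : FiniteDimensional ℝ V := .span_of_finite ℝ hV
  let _ : MeasurableSpace V := borel V
  have : BorelSpace V := ⟨rfl⟩
  obtain ⟨X, hX, hinner, hmap⟩ := ProbabilityTheory.exists_map_eq_stdGaussian P
    (Φ ∘ₗ V.subtype) (fun v => hmeas v) (fun v => hchar v)
  have hΦ : ∀ v ∈ V, ∀ ω, Φ v ω = ⟪v, (X ω : L)⟫ := fun v hv ω => (hinner ⟨v, hv⟩ ω).symm
  have hh : ∀ i, h i ∈ V := fun i => Submodule.subset_span (.inl (.inl ⟨i, rfl⟩))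
  have hk : ∀ j, k j ∈ V := fun j => Submodule.subset_span (.inl (.inr ⟨j, rfl⟩))
  have hl : l ∈ V := Submodule.subset_span (.inr rfl)
  have hf : Continuous fun x : V => MvPolynomial.eval (fun i => ⟪h i, (x : L)⟫) p :=
    p.continuous_eval.comp (by fun_prop)
  have hg : Continuous fun x : V => MvPolynomial.eval (fun j => ⟪k j, (x : L)⟫) q :=
    q.continuous_eval.comp (by fun_prop)
  have hfg := (hf.ae_eq_iff_eq (ProbabilityTheory.stdGaussian V) hg).1 <| by
    rw [← hmap]
    refine (ae_map_iff hX.aemeasurable (measurableSet_eq_fun hf.measurable hg.measurable)).2 ?_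
    filter_upwards [heq] with ω hω
    simpa only [hΦ _ (hh _), hΦ _ (hk _)] using hω
  refine .of_forall fun ω => ?_
  have hp := p.hasDerivAt_eval_add_mul (fun i => Φ (h i) ω) (fun i => ⟪h i, l⟫) 0
  have hq := q.hasDerivAt_eval_add_mul (fun j => Φ (k j) ω) (fun j => ⟪k j, l⟫) 0
  have hline : (fun s : ℝ => MvPolynomial.eval (fun i => Φ (h i) ω + s * ⟪h i, l⟫) p)
      = fun s : ℝ => MvPolynomial.eval (fun j => Φ (k j) ω + s * ⟪k j, l⟫) q := by
    ext s
    simpa [inner_add_right, inner_smul_right, hΦ _ (hh _), hΦ _ (hk _)]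
      using congrFun hfg (X ω + s • ⟨l, hl⟩)
  rw [hline] at hp
  simpa using hp.unique hq
end

section
/- For every k ∈ ℒ and every polynomial field G = q(Φ(h₁), …, Φ(hₙ)), one has 𝔼[exp(Φ(k))·T_k(G)] = 𝔼[(Φ(k) − ‖k‖²)·exp(Φ(k))·G]. This is the weak form of the identity T*T̄(e^{Φ(k)}) = (Φ(k) − ‖k‖²)·e^{Φ(k)} for the Malliavin derivative T and its adjoint T*, using that T̄(e^{Φ(k)}) = e^{Φ(k)} ⊗ k. -/
open MeasureTheory
open scoped RealInnerProductSpace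

open ProbabilityTheory
open scoped NNReal ENNReal

/-- A function lying in every `Lᵖ` space with `p` finite. -/
def HasAllMoments {Ω : Type*} [MeasurableSpace Ω] (P : Measure Ω) (f : Ω → ℝ) : Prop :=
  ∀ p : ℝ≥0∞, p ≠ ∞ → MemLp f p P

namespace HasAllMoments

variable {Ω : Type*} [MeasurableSpace Ω] {P : Measure Ω} {f g : Ω → ℝ}

lemma integrable (hf : HasAllMoments P f) : Integrable f P :=
  memLp_one_iff_integrable.1 (hf 1 (by simp))

lemma aestronglyMeasurable (hf : HasAllMoments P f) : AEStronglyMeasurable f P :=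
  hf.integrable.aestronglyMeasurable

lemma add (hf : HasAllMoments P f) (hg : HasAllMoments P g) :
    HasAllMoments P (fun ω => f ω + g ω) :=
  fun p hp => (hf p hp).add (hg p hp)

lemma mul (hf : HasAllMoments P f) (hg : HasAllMoments P g) :
    HasAllMoments P (fun ω => f ω * g ω) := by
  intro p hp
  have hp2 : 2 * p ≠ ∞ := ENNReal.mul_ne_top (by simp) hp
  have : ENNReal.HolderTriple (2 * p) (2 * p) p := ⟨by
    rw [ENNReal.mul_inv (by simp) (by simp), ← add_mul, ENNReal.inv_two_add_inv_two, one_mul]⟩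
  exact (hg _ hp2).mul' (hf _ hp2)

lemma abs (hf : HasAllMoments P f) : HasAllMoments P (fun ω => |f ω|) :=
  fun p hp => (hf p hp).abs

lemma const [IsFiniteMeasure P] (c : ℝ) : HasAllMoments P (fun _ => c) :=
  fun _ _ => memLp_const c

lemma sum {ι : Type*} (s : Finset ι) {f : ι → Ω → ℝ} (hf : ∀ i ∈ s, HasAllMoments P (f i)) :
    HasAllMoments P (fun ω => ∑ i ∈ s, f i ω) :=
  fun p hp => memLp_finsetSum s fun i hi => hf i hi p hp

lemma eval_mvPolynomial [IsFiniteMeasure P] {σ : Type*} {f : σ → Ω → ℝ}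
    (hf : ∀ i, HasAllMoments P (f i)) (q : MvPolynomial σ ℝ) :
    HasAllMoments P (fun ω => MvPolynomial.eval (fun i => f i ω) q) := by
  induction q using MvPolynomial.induction_on with
  | C a => simpa using const a
  | add p q hp hq => simpa using hp.add hq
  | mul_X p i hp => simpa using hp.mul (hf i)

end HasAllMoments

section Gaussian

variable {Ω : Type*} [MeasurableSpace Ω] {P : Measure Ω}

lemma hasAllMoments_of_map_eq_gaussianReal {X : Ω → ℝ} (hX : Measurable X) {μ : ℝ} {v : ℝ≥0}
    (h : P.map X = gaussianReal μ v) : HasAllMoments P X := by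
  intro p hp
  have := memLp_id_gaussianReal' (μ := μ) (v := v) p hp
  rw [← h] at this
  exact this.comp_of_map hX.aemeasurable

lemma hasAllMoments_exp_of_map_eq_gaussianReal {X : Ω → ℝ} (hX : Measurable X) {μ : ℝ} {v : ℝ≥0}
    (h : P.map X = gaussianReal μ v) : HasAllMoments P (fun ω => Real.exp (X ω)) := by
  intro p hp
  have hm : AEStronglyMeasurable (fun ω => Real.exp (X ω)) P := by fun_prop
  rcases eq_or_ne p 0 with rfl | h0
  · exact memLp_zero_iff_aestronglyMeasurable.2 hm
  rw [← integrable_norm_rpow_iff hm h0 hp]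
  have := integrable_exp_mul_gaussianReal (μ := μ) (v := v) p.toReal
  rw [← h] at this
  refine (this.comp_measurable hX).congr (.of_forall fun ω => ?_)
  simp [← Real.exp_mul, mul_comm]

variable {L : Type*} [NormedAddCommGroup L] [InnerProductSpace ℝ L] {Φ : L →ₗ[ℝ] (Ω → ℝ)}

lemma integral_exp_of_map_eq_gaussianReal {k : L}
    (hΦ : P.map (Φ k) = gaussianReal 0 (‖k‖₊ ^ 2)) :
    ∫ ω, Real.exp (Φ k ω) ∂P = Real.exp (‖k‖ ^ 2 / 2) := by
  simpa [mgf] using mgf_gaussianReal hΦ 1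

lemma hasDerivAt_norm_add_smul_sq (k a : L) :
    HasDerivAt (fun s : ℝ => ‖k + s • a‖ ^ 2) (2 * ⟪k, a⟫) 0 := by
  simpa using (((hasDerivAt_id (0 : ℝ)).smul_const a).const_add k).norm_sq

/-- Differentiation of `s ↦ 𝔼[exp(Φ(k + s a)) f]` under the expectation. -/
lemma hasDerivAt_integral_exp_mul (hmeas : ∀ k : L, Measurable (Φ k))
    (hΦ : ∀ k, P.map (Φ k) = gaussianReal 0 (‖k‖₊ ^ 2)) (k a : L) {f : Ω → ℝ}
    (hf : HasAllMoments P f) :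
    HasDerivAt (fun s : ℝ => ∫ ω, Real.exp (Φ (k + s • a) ω) * f ω ∂P)
      (∫ ω, Real.exp (Φ k ω) * (Φ a ω * f ω) ∂P) 0 := by
  have hX k := hasAllMoments_of_map_eq_gaussianReal (hmeas k) (hΦ k)
  have hE k := hasAllMoments_exp_of_map_eq_gaussianReal (hmeas k) (hΦ k)
  have key := hasDerivAt_integral_of_dominated_loc_of_deriv_le (μ := P) (x₀ := (0 : ℝ))
    (F := fun s ω => Real.exp (Φ (k + s • a) ω) * f ω)
    (F' := fun s ω => Real.exp (Φ (k + s • a) ω) * (Φ a ω * f ω))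
    (bound := fun ω => (Real.exp (Φ (k + a) ω) + Real.exp (Φ (k + -a) ω)) * |Φ a ω * f ω|)
    (s := Metric.ball 0 1) (Metric.ball_mem_nhds _ one_pos)
    (.of_forall fun s => ((hE _).mul hf).aestronglyMeasurable)
    ((hE _).mul hf).integrable
    ((hE _).mul ((hX a).mul hf)).aestronglyMeasurable
    (.of_forall fun ω s hs => ?_)
    (((hE _).add (hE _)).mul ((hX a).mul hf).abs).integrable
    (.of_forall fun ω s hs => ?_)
  · simpa using key.2
  · have hs' : |s| < 1 := by simpa using hs
    rw [norm_mul, Real.norm_eq_abs, Real.norm_eq_abs, Real.abs_exp]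
    gcongr
    simp only [map_add, map_smul, map_neg, Pi.add_apply, Pi.smul_apply, Pi.neg_apply, smul_eq_mul]
    obtain ⟨h1, h2⟩ := abs_lt.1 hs'
    rcases le_total 0 (Φ a ω) with h | h
    · have : Real.exp (Φ k ω + s * Φ a ω) ≤ Real.exp (Φ k ω + Φ a ω) :=
        Real.exp_le_exp.2 (by nlinarith)
      linarith [Real.exp_pos (Φ k ω + -Φ a ω)]
    · have : Real.exp (Φ k ω + s * Φ a ω) ≤ Real.exp (Φ k ω + -Φ a ω) :=
        Real.exp_le_exp.2 (by nlinarith)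
      linarith [Real.exp_pos (Φ k ω + Φ a ω)]
  · simp only [map_add, map_smul, Pi.add_apply, Pi.smul_apply, smul_eq_mul]
    have h := ((((hasDerivAt_id s).mul_const (Φ a ω)).const_add (Φ k ω)).exp).mul_const (f ω)
    simpa [mul_assoc] using h

variable [IsProbabilityMeasure P]

lemma map_eq_gaussianReal (hmeas : ∀ k : L, Measurable (Φ k))
    (hchar : ∀ k : L, ∫ ω, Complex.exp (Complex.I * (Φ k ω : ℂ)) ∂P
        = (Real.exp (-‖k‖ ^ 2 / 2) : ℂ)) (k : L) :
    P.map (Φ k) = gaussianReal 0 (‖k‖₊ ^ 2) := by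
  have := Measure.isProbabilityMeasure_map (μ := P) (hmeas k).aemeasurable
  refine Measure.ext_of_charFun (funext fun t => ?_)
  rw [charFun_gaussianReal, charFun_apply_real,
    integral_map (hmeas k).aemeasurable (by fun_prop)]
  have h := hchar (t • k)
  simp only [map_smul, Pi.smul_apply, smul_eq_mul, Complex.ofReal_mul, norm_smul] at h
  simp only [mul_comm _ Complex.I]
  rw [h]
  push_cast
  congr 1
  have : (((‖t‖ ^ 2 : ℝ)) : ℂ) = t ^ 2 := by simp
  push_cast at this
  simp only [mul_pow, this]
  ring

/-- Gaussian integration by parts in direction `v` for `exp(Φ(k))` times a polynomial field. -/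
lemma integral_exp_mul_mul_eval (hmeas : ∀ k : L, Measurable (Φ k))
    (hΦ : ∀ k, P.map (Φ k) = gaussianReal 0 (‖k‖₊ ^ 2)) {n : ℕ} (h : Fin n → L) (v : L)
    (q : MvPolynomial (Fin n) ℝ) (k : L) :
    ∫ ω, Real.exp (Φ k ω) * (Φ v ω * MvPolynomial.eval (fun j => Φ (h j) ω) q) ∂P
      = ∫ ω, Real.exp (Φ k ω) * ∑ i : Fin n,
          MvPolynomial.eval (fun j => Φ (h j) ω) (MvPolynomial.pderiv i q) * ⟪h i, v⟫ ∂P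
        + ⟪k, v⟫ * ∫ ω, Real.exp (Φ k ω) * MvPolynomial.eval (fun j => Φ (h j) ω) q ∂P := by
  have hX k := hasAllMoments_of_map_eq_gaussianReal (hmeas k) (hΦ k)
  have hE k := hasAllMoments_exp_of_map_eq_gaussianReal (hmeas k) (hΦ k)
  have hq (q : MvPolynomial (Fin n) ℝ) := HasAllMoments.eval_mvPolynomial (fun j => hX (h j)) q
  have hD (q : MvPolynomial (Fin n) ℝ) : HasAllMoments P (fun ω => ∑ i : Fin n,
      MvPolynomial.eval (fun j => Φ (h j) ω) (MvPolynomial.pderiv i q) * ⟪h i, v⟫) :=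
    .sum _ fun i _ => (hq _).mul (.const _)
  induction q using MvPolynomial.induction_on generalizing k with
  | C c =>
    have h1 := hasDerivAt_integral_exp_mul hmeas hΦ k v (HasAllMoments.const c)
    simp_rw [integral_mul_const, integral_exp_of_map_eq_gaussianReal (hΦ _)] at h1
    have h2 := (((hasDerivAt_norm_add_smul_sq k v).div_const 2).exp).mul_const c
    simp only [MvPolynomial.eval_C, MvPolynomial.pderiv_C, map_zero, zero_mul,
      Finset.sum_const_zero, mul_zero, integral_zero, zero_add, integral_mul_const,
      integral_exp_of_map_eq_gaussianReal (hΦ k)]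
    rw [h1.unique h2]
    simp
    ring
  | add p q ihp ihq =>
    simp only [map_add, mul_add, add_mul, Finset.sum_add_distrib]
    rw [integral_add ((hE k).mul ((hX v).mul (hq p))).integrable
        ((hE k).mul ((hX v).mul (hq q))).integrable,
      integral_add ((hE k).mul (hD p)).integrable ((hE k).mul (hD q)).integrable,
      integral_add ((hE k).mul (hq p)).integrable ((hE k).mul (hq q)).integrable, ihp, ihq]
    ring
  | mul_X q j ih =>
    have h1 := hasDerivAt_integral_exp_mul hmeas hΦ k (h j) ((hX v).mul (hq q))
    have h2 := hasDerivAt_integral_exp_mul hmeas hΦ k (h j) (hD q)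
    have h3 := hasDerivAt_integral_exp_mul hmeas hΦ k (h j) (hq q)
    have h4 : HasDerivAt (fun s : ℝ => ⟪k + s • h j, v⟫) ⟪h j, v⟫ 0 := by
      simp only [inner_add_left, real_inner_smul_left]
      simpa using ((hasDerivAt_id (0 : ℝ)).mul_const ⟪h j, v⟫).const_add ⟪k, v⟫
    simp_rw [ih] at h1
    have h5 := h1.unique (h2.add (h4.mul h3))
    have hsum (ω : Ω) : ∑ i : Fin n, MvPolynomial.eval (fun j => Φ (h j) ω)
          (MvPolynomial.pderiv i (q * MvPolynomial.X j)) * ⟪h i, v⟫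
        = Φ (h j) ω * (∑ i : Fin n,
            MvPolynomial.eval (fun j => Φ (h j) ω) (MvPolynomial.pderiv i q) * ⟪h i, v⟫)
          + MvPolynomial.eval (fun j => Φ (h j) ω) q * ⟪h j, v⟫ := by
      classical
      simp [MvPolynomial.pderiv_X, Pi.single_apply, Finset.mul_sum, apply_ite, mul_left_comm,
        mul_comm]
      simp [mul_add, Finset.sum_add_distrib, add_comm]
    simp only [zero_smul, add_zero] at h5
    simp_rw [hsum, mul_add]
    rw [integral_add ((hE k).mul ((hX _).mul (hD q))).integrable
      ((hE k).mul ((hq q).mul (.const _))).integrable]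
    simp only [← mul_assoc, integral_mul_const, map_mul, MvPolynomial.eval_X] at h5 ⊢
    simp only [mul_comm, mul_left_comm, mul_assoc] at h5 ⊢
    linarith

end Gaussian

/-- For every k ∈ ℒ and every polynomial field G = q(Φ(h₁),…,Φ(hₙ)),
𝔼[exp(Φ(k))·T_k(G)] = 𝔼[(Φ(k) − ‖k‖²)·exp(Φ(k))·G]; this is the weak form of
T*T̄(e^{Φ(k)}) = (Φ(k) − ‖k‖²)·e^{Φ(k)}. -/
theorem adjoint_on_exponential_weak
    {Ω : Type*} [MeasurableSpace Ω] (P : Measure Ω) [IsProbabilityMeasure P]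
    {L : Type*} [NormedAddCommGroup L] [InnerProductSpace ℝ L]
    (Φ : L →ₗ[ℝ] (Ω → ℝ))
    (hmeas : ∀ k : L, Measurable (Φ k))
    (hchar : ∀ k : L, ∫ ω, Complex.exp (Complex.I * (Φ k ω : ℂ)) ∂P
        = (Real.exp (-‖k‖ ^ 2 / 2) : ℂ))
    (k : L) (n : ℕ) (h : Fin n → L) (q : MvPolynomial (Fin n) ℝ) :
    ∫ ω, Real.exp (Φ k ω) *
        ∑ i : Fin n,
          MvPolynomial.eval (fun j => Φ (h j) ω) (MvPolynomial.pderiv i q) * ⟪h i, k⟫ ∂P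
      = ∫ ω, (Φ k ω - ‖k‖ ^ 2) * Real.exp (Φ k ω) *
          MvPolynomial.eval (fun j => Φ (h j) ω) q ∂P := by
  have hΦ := map_eq_gaussianReal hmeas hchar
  have hE := hasAllMoments_exp_of_map_eq_gaussianReal (hmeas k) (hΦ k)
  have hX k := hasAllMoments_of_map_eq_gaussianReal (hmeas k) (hΦ k)
  have hq := HasAllMoments.eval_mvPolynomial (fun j => hX (h j)) q
  have hibp := integral_exp_mul_mul_eval hmeas hΦ h k q k
  rw [real_inner_self_eq_norm_sq, ← integral_const_mul] at hibp
  rw [← sub_eq_iff_eq_add, ← integral_sub (hE.mul ((hX k).mul hq)).integrable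
    ((hE.mul hq).integrable.const_mul _)] at hibp
  rw [← hibp]
  congr with ω
  ring
end

section
/- Let h₁, …, hₙ ∈ ℒ be orthonormal and p, q ∈ ℝ[x₁, …, xₙ]. Then 𝔼[Σᵢ₌₁ⁿ (∂p/∂xᵢ)(Φ(h₁), …, Φ(hₙ))·(∂q/∂xᵢ)(Φ(h₁), …, Φ(hₙ))] = 𝔼[q(Φ(h₁), …, Φ(hₙ))·(−Σᵢ₌₁ⁿ (∂²p/∂xᵢ²)(Φ(h₁), …, Φ(hₙ)) + Σᵢ₌₁ⁿ Φ(hᵢ)·(∂p/∂xᵢ)(Φ(h₁), …, Φ(hₙ)))]. That is, on polynomial fields the operator T*T equals −Δ + ∇_Φ, where Δ is the coordinate Laplacian and ∇_Φ the Φ-gradient. -/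
open MeasureTheory
open scoped RealInnerProductSpace

namespace GaussianField

open ProbabilityTheory MvPolynomial

lemma integrable_pow_gaussianReal (k : ℕ) :
    Integrable (fun x : ℝ => x ^ k) (gaussianReal 0 1) := by
  rcases Nat.eq_zero_or_pos k with rfl | hk
  · simp
  · have hmem := memLp_id_gaussianReal (μ := 0) (v := 1) (k : NNReal)
    refine (integrable_norm_iff (by fun_prop)).1 ?_
    have := hmem.integrable_norm_pow (p := k) hk.ne'
    simpa [norm_pow] using this

lemma hasDerivAt_gaussianPDFReal (x : ℝ) :
    HasDerivAt (gaussianPDFReal 0 1) (-(x * gaussianPDFReal 0 1 x)) x := by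
  have hexp : HasDerivAt (fun y : ℝ => -(y - 0) ^ 2 / (2 * ((1 : NNReal) : ℝ))) (-x) x := by
    have := ((((hasDerivAt_id x).sub_const 0).pow 2).neg).div_const (2 * ((1 : NNReal) : ℝ))
    refine this.congr_deriv ?_
    simp
    ring
  refine (hexp.exp.const_mul (Real.sqrt (2 * Real.pi * ((1 : NNReal) : ℝ)))⁻¹).congr_deriv ?_
  rw [gaussianPDFReal]
  ring

lemma integrable_pow_mul_gaussianPDFReal (k : ℕ) :
    Integrable (fun x : ℝ => x ^ k * gaussianPDFReal 0 1 x) := by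
  have := integrable_pow_gaussianReal k
  rw [gaussianReal_of_var_ne_zero 0 one_ne_zero,
    integrable_withDensity_iff_integrable_smul' (measurable_gaussianPDF 0 1)
      (ae_of_all _ fun _ => gaussianPDF_lt_top)] at this
  simpa [mul_comm] using this

/-- The moment recursion of the standard Gaussian distribution. -/
lemma integral_pow_succ_gaussianReal (k : ℕ) :
    ∫ x, x ^ (k + 1) ∂gaussianReal 0 1 = k * ∫ x, x ^ (k - 1) ∂gaussianReal 0 1 := by
  have hparts := integral_mul_deriv_eq_deriv_mul_of_integrable
    (u := fun x : ℝ => x ^ k) (u' := fun x : ℝ => k * x ^ (k - 1))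
    (v := gaussianPDFReal 0 1) (v' := fun x => -(x * gaussianPDFReal 0 1 x))
    (fun x _ => hasDerivAt_pow k x) (fun x _ => hasDerivAt_gaussianPDFReal x)
    ((integrable_pow_mul_gaussianPDFReal (k + 1)).neg.congr
      (ae_of_all _ fun x => by simp only [Pi.neg_apply, Pi.mul_apply]; ring))
    (((integrable_pow_mul_gaussianPDFReal (k - 1)).const_mul (k : ℝ)).congr
      (ae_of_all _ fun x => by simp only [Pi.mul_apply]; ring))
    (integrable_pow_mul_gaussianPDFReal k)
  simp only [integral_gaussianReal_eq_integral_smul one_ne_zero, smul_eq_mul]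
  rw [← integral_const_mul]
  have hl : ∀ x : ℝ, gaussianPDFReal 0 1 x * x ^ (k + 1)
      = -(x ^ k * -(x * gaussianPDFReal 0 1 x)) := fun x => by ring
  have hr : ∀ x : ℝ, (k : ℝ) * (gaussianPDFReal 0 1 x * x ^ (k - 1))
      = k * x ^ (k - 1) * gaussianPDFReal 0 1 x := fun x => by ring
  simp only [hl, hr]
  rw [integral_neg, hparts, neg_neg]

/-- The standard Gaussian measure on `ι → ℝ`. -/
noncomputable abbrev stdPi (ι : Type*) [Fintype ι] : Measure (ι → ℝ) :=
  Measure.pi fun _ => gaussianReal 0 1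

variable {ι : Type*} [Fintype ι]

lemma eval_monomial_eq_mul_prod (x : ι → ℝ) (m : ι →₀ ℕ) (a : ℝ) :
    eval x (monomial m a) = a * ∏ j, x j ^ m j := by
  rw [eval_monomial, Finsupp.prod_fintype _ _ fun _ => pow_zero _]

lemma integrable_eval_stdPi (f : MvPolynomial ι ℝ) :
    Integrable (fun x => eval x f) (stdPi ι) := by
  induction f using MvPolynomial.induction_on' with
  | monomial m a =>
    simp only [eval_monomial_eq_mul_prod]
    exact (Integrable.fintype_prod (f := fun j (y : ℝ) => y ^ m j)
      fun j => integrable_pow_gaussianReal (m j)).const_mul a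
  | add f g hf hg =>
    simp only [map_add]
    exact hf.add hg

lemma integral_eval_monomial_stdPi (m : ι →₀ ℕ) (a : ℝ) :
    ∫ x, eval x (monomial m a) ∂stdPi ι
      = a * ∏ j, ∫ y, y ^ m j ∂gaussianReal 0 1 := by
  simp only [eval_monomial_eq_mul_prod]
  rw [integral_const_mul, integral_fintype_prod_eq_prod (f := fun j (y : ℝ) => y ^ m j)]

/-- Gaussian integration by parts for polynomials. -/
lemma integral_eval_X_mul_stdPi (i : ι) (f : MvPolynomial ι ℝ) :
    ∫ x, eval x (X i * f) ∂stdPi ι = ∫ x, eval x (pderiv i f) ∂stdPi ι := by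
  classical
  induction f using MvPolynomial.induction_on' with
  | monomial m a =>
    rw [pderiv_monomial, X, monomial_mul, one_mul, integral_eval_monomial_stdPi,
      integral_eval_monomial_stdPi, ← Finset.mul_prod_erase _ _ (Finset.mem_univ i),
      ← Finset.mul_prod_erase _
        (fun j => ∫ y, y ^ (m - Finsupp.single i 1 : ι →₀ ℕ) j ∂gaussianReal 0 1)
        (Finset.mem_univ i)]
    have hoff : ∀ j ∈ Finset.univ.erase i,
        ∫ y, y ^ (Finsupp.single i 1 + m : ι →₀ ℕ) j ∂gaussianReal 0 1
          = ∫ y, y ^ (m - Finsupp.single i 1 : ι →₀ ℕ) j ∂gaussianReal 0 1 := fun j hj => by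
      simp [Finsupp.single_eq_of_ne (Finset.ne_of_mem_erase hj)]
    rw [Finset.prod_congr rfl hoff]
    have hon : ∫ y, y ^ (Finsupp.single i 1 + m : ι →₀ ℕ) i ∂gaussianReal 0 1
        = m i * ∫ y, y ^ (m - Finsupp.single i 1 : ι →₀ ℕ) i ∂gaussianReal 0 1 := by
      simpa [add_comm] using integral_pow_succ_gaussianReal (m i)
    rw [hon]
    ring
  | add f g hf hg =>
    simp only [mul_add, map_add (eval _), map_add (pderiv i)]
    rw [integral_add (integrable_eval_stdPi _) (integrable_eval_stdPi _),
      integral_add (integrable_eval_stdPi _) (integrable_eval_stdPi _), hf, hg]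

lemma integral_pderiv_mul_pderiv_stdPi (p q : MvPolynomial ι ℝ) :
    ∫ x, eval x (∑ i, pderiv i p * pderiv i q) ∂stdPi ι
      = ∫ x, eval x (q * (-(∑ i, pderiv i (pderiv i p)) + ∑ i, X i * pderiv i p)) ∂stdPi ι := by
  have hsplit : q * (-(∑ i, pderiv i (pderiv i p)) + ∑ i, X i * pderiv i p)
      = ∑ i, (X i * (q * pderiv i p) - q * pderiv i (pderiv i p)) := by
    rw [Finset.sum_sub_distrib, mul_add, mul_neg, Finset.mul_sum, Finset.mul_sum,
      neg_add_eq_sub]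
    congr 1
    exact Finset.sum_congr rfl fun i _ => by ring
  rw [hsplit]
  simp only [map_sum]
  rw [integral_finsetSum _ fun i _ => integrable_eval_stdPi _,
    integral_finsetSum _ fun i _ => integrable_eval_stdPi _]
  refine Finset.sum_congr rfl fun i _ => ?_
  simp only [map_sub]
  rw [integral_sub (integrable_eval_stdPi _) (integrable_eval_stdPi _),
    integral_eval_X_mul_stdPi, ← integral_sub (integrable_eval_stdPi _) (integrable_eval_stdPi _)]
  simp only [← map_sub, pderiv_mul]
  congr! 3
  ring

/-- A family whose linear combinations have the characteristic functions of centred Gaussians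
of variance `‖t‖ ^ 2` has the standard Gaussian measure as its joint law. -/
lemma map_eq_stdPi {Ω : Type*} [MeasurableSpace Ω] (P : Measure Ω) [IsProbabilityMeasure P]
    (Y : ι → Ω → ℝ) (hY : ∀ i, Measurable (Y i))
    (hchar : ∀ t : ι → ℝ, ∫ ω, Complex.exp (Complex.I * ((∑ i, t i * Y i ω : ℝ) : ℂ)) ∂P
        = (Real.exp (-(∑ i, t i ^ 2) / 2) : ℂ)) :
    P.map (fun ω i => Y i ω) = stdPi ι := by
  classical
  have hmeas : Measurable fun ω i => Y i ω := measurable_pi_lambda _ hY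
  have : IsProbabilityMeasure (P.map fun ω i => Y i ω) :=
    Measure.isProbabilityMeasure_map hmeas.aemeasurable
  rw [stdPi, ← charFun_eq_pi_iff]
  intro t
  rw [charFun_apply, integral_map (by fun_prop) (by fun_prop),
    integral_map (by fun_prop) (by fun_prop)]
  have h := hchar t
  simp only [charFun_gaussianReal]
  rw [← Complex.exp_sum]
  convert h using 1
  · congr! 3 with ω
    simp [PiLp.inner_apply, mul_comm]
  · push_cast
    congr 1
    simp [Finset.sum_div, neg_div, Finset.sum_neg_distrib]

end GaussianField

/-- For orthonormal h₁,…,hₙ ∈ ℒ and p, q ∈ ℝ[x₁,…,xₙ],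
𝔼[Σᵢ (∂p/∂xᵢ)(Φ(h))·(∂q/∂xᵢ)(Φ(h))] =
𝔼[q(Φ(h))·(−Σᵢ (∂²p/∂xᵢ²)(Φ(h)) + Σᵢ Φ(hᵢ)·(∂p/∂xᵢ)(Φ(h)))];
i.e. on polynomial fields T*T = −Δ + ∇_Φ (weak formulation ⟨TF, TG⟩ = ⟨(−Δ+∇_Φ)F, G⟩). -/
theorem malliavin_TstarT_eq_laplacian_plus_gradient
    {Ω : Type*} [MeasurableSpace Ω] (P : Measure Ω) [IsProbabilityMeasure P]
    {L : Type*} [NormedAddCommGroup L] [InnerProductSpace ℝ L]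
    (Φ : L →ₗ[ℝ] (Ω → ℝ))
    (hmeas : ∀ k : L, Measurable (Φ k))
    (hchar : ∀ k : L, ∫ ω, Complex.exp (Complex.I * (Φ k ω : ℂ)) ∂P
        = (Real.exp (-‖k‖ ^ 2 / 2) : ℂ))
    (n : ℕ) (h : Fin n → L) (horth : Orthonormal ℝ h)
    (p q : MvPolynomial (Fin n) ℝ) :
    ∫ ω, ∑ i : Fin n,
        MvPolynomial.eval (fun j => Φ (h j) ω) (MvPolynomial.pderiv i p) *
          MvPolynomial.eval (fun j => Φ (h j) ω) (MvPolynomial.pderiv i q) ∂P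
      = ∫ ω, MvPolynomial.eval (fun j => Φ (h j) ω) q *
          (-(∑ i : Fin n,
              MvPolynomial.eval (fun j => Φ (h j) ω)
                (MvPolynomial.pderiv i (MvPolynomial.pderiv i p)))
            + ∑ i : Fin n,
                Φ (h i) ω *
                  MvPolynomial.eval (fun j => Φ (h j) ω) (MvPolynomial.pderiv i p)) ∂P := by
  have hlaw : P.map (fun ω i => Φ (h i) ω) = GaussianField.stdPi (Fin n) := by
    refine GaussianField.map_eq_stdPi P (fun i => Φ (h i)) (fun i => hmeas _) fun t => ?_
    have hnorm : ‖∑ i, t i • h i‖ ^ 2 = ∑ i, t i ^ 2 := by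
      rw [← real_inner_self_eq_norm_sq, horth.inner_sum]
      simp [sq]
    rw [← hnorm, ← hchar]
    simp [map_sum, Finset.sum_apply]
  have hmap : ∀ f : MvPolynomial (Fin n) ℝ,
      ∫ ω, MvPolynomial.eval (fun j => Φ (h j) ω) f ∂P
        = ∫ x, MvPolynomial.eval x f ∂GaussianField.stdPi (Fin n) := fun f => by
    rw [← hlaw, integral_map (measurable_pi_lambda _ fun i => hmeas _).aemeasurable
      (MvPolynomial.continuous_eval f).aestronglyMeasurable]
  have hparts := GaussianField.integral_pderiv_mul_pderiv_stdPi p q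
  rw [← hmap, ← hmap] at hparts
  simpa only [map_sum, map_mul, map_add, map_neg, MvPolynomial.eval_X] using hparts
end
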